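/- Let f : V → U be a morphism of persistence modules over ℝ, let ε > 0, and let I, J be intervals of ℝ. Denote by I^ε the interval with the same left endpoint as I and right endpoint shifted by +ε. Then for every t ∈ I ∩ J, X_{IJ}[1_ε(f)](t) ≅ X_{I^ε J^ε}[f](t + ε), where 1_ε(f) : Im 1_ε^V → Im 1_ε^U is the restriction of the ε-shifted morphism f^ε to the image of the ε-transition morphism. -/

import Mathlib

/-!
Basic notions for persistence modules indexed over `ℝ`, following
Crawley-Boevey's decomposition theory.  A persistence module is given by a
family of vector spaces `V t` together with structure maps
`ρ s t : V s →ₗ[k] V t` for `s ≤ t`.  An interval of `ℝ` (possibly with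
decorated endpoints) is encoded as an order-connected subset `I : Set ℝ`;
for `t ∈ I` the sets `{s | s ≤ t ∧ s ∈ I}`, `{s | s ≤ t ∧ s ∉ I}`,
`{r | t ≤ r ∧ r ∉ I}` and `{r | t ≤ r ∧ r ∈ I}` are exactly
`⟨a, t⁺⟩`, `⟨-∞, a⟩`, `⟨b, ∞⟩` and `⟨t⁻, b⟩` for `I = ⟨a, b⟩`.
-/

open scoped Classical

noncomputable section

variable (k : Type) [Field k]

section Defs

variable (V : ℝ → Type) [∀ t, AddCommGroup (V t)] [∀ t, Module k (V t)]
variable (ρ : ∀ s t : ℝ, s ≤ t → (V s →ₗ[k] V t))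

/-- `(V, ρ)` is a functor `ℝ → vect`: a persistence module. -/
def IsPersistenceModule : Prop :=
  (∀ t (x : V t), ρ t t le_rfl x = x) ∧
    ∀ s t u (hst : s ≤ t) (htu : t ≤ u) (x : V s),
      ρ t u htu (ρ s t hst x) = ρ s u (hst.trans htu) x

/-- Descending chain condition on images. -/
def DCCImages : Prop :=
  ∀ t : ℝ, ∀ s : ℕ → ℝ, ∀ h : ∀ n, s n ≤ t, Antitone s →
    ∃ N, ∀ n, N ≤ n →
      LinearMap.range (ρ (s n) t (h n)) = LinearMap.range (ρ (s N) t (h N))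

/-- Descending chain condition on kernels. -/
def DCCKernels : Prop :=
  ∀ t : ℝ, ∀ r : ℕ → ℝ, ∀ h : ∀ n, t ≤ r n, Monotone r →
    ∃ N, ∀ n, N ≤ n →
      LinearMap.ker (ρ t (r n) (h n)) = LinearMap.ker (ρ t (r N) (h N))

/-- `Im⁺_{at}(V) = ⋂_{s ∈ ⟨a,t⁺⟩} Im ρ_{st}`, for `I = ⟨a,b⟩` and `t ∈ I`. -/
def ImP (I : Set ℝ) (t : ℝ) : Submodule k (V t) :=
  ⨅ s : {s : ℝ // s ≤ t ∧ s ∈ I}, LinearMap.range (ρ s.1 t s.2.1)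

/-- `Im⁻_{at}(V) = ⋃_{s < a} Im ρ_{st}`, for `I = ⟨a,b⟩` and `t ∈ I`. -/
def ImM (I : Set ℝ) (t : ℝ) : Submodule k (V t) :=
  ⨆ s : {s : ℝ // s ≤ t ∧ s ∉ I}, LinearMap.range (ρ s.1 t s.2.1)

/-- `Ker⁺_{bt}(V) = ⋂_{r > b} Ker ρ_{tr}`, for `I = ⟨a,b⟩` and `t ∈ I`. -/
def KerP (I : Set ℝ) (t : ℝ) : Submodule k (V t) :=
  ⨅ r : {r : ℝ // t ≤ r ∧ r ∉ I}, LinearMap.ker (ρ t r.1 r.2.1)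

/-- `Ker⁻_{bt}(V) = ⋃_{t ≤ r < b} Ker ρ_{tr}`, for `I = ⟨a,b⟩` and `t ∈ I`. -/
def KerM (I : Set ℝ) (t : ℝ) : Submodule k (V t) :=
  ⨆ r : {r : ℝ // t ≤ r ∧ r ∈ I}, LinearMap.ker (ρ t r.1 r.2.1)

/-- `V⁺_{It}` (and `0` outside `I`). -/
def Vp (I : Set ℝ) (t : ℝ) : Submodule k (V t) :=
  if t ∈ I then ImP k V ρ I t ⊓ KerP k V ρ I t else ⊥

/-- `V⁻_{It}` (and `0` outside `I`). -/
def Vm (I : Set ℝ) (t : ℝ) : Submodule k (V t) :=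
  if t ∈ I then
    ImM k V ρ I t ⊓ KerP k V ρ I t ⊔ ImP k V ρ I t ⊓ KerM k V ρ I t
  else ⊥

/-- The quotient `V_{It} = V⁺_{It}/V⁻_{It}`. -/
def VIq (I : Set ℝ) (t : ℝ) : Type :=
  ↥(Vp k V ρ I t) ⧸ Submodule.comap (Vp k V ρ I t).subtype (Vm k V ρ I t)

instance (I : Set ℝ) (t : ℝ) : AddCommGroup (VIq k V ρ I t) := by
  unfold VIq; infer_instance

instance (I : Set ℝ) (t : ℝ) : Module k (VIq k V ρ I t) := by
  unfold VIq; infer_instance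

end Defs

section Mor

variable (V : ℝ → Type) [∀ t, AddCommGroup (V t)] [∀ t, Module k (V t)]
variable (ρ : ∀ s t : ℝ, s ≤ t → (V s →ₗ[k] V t))
variable (U : ℝ → Type) [∀ t, AddCommGroup (U t)] [∀ t, Module k (U t)]
variable (φ : ∀ s t : ℝ, s ≤ t → (U s →ₗ[k] U t))
variable (f : ∀ t, V t →ₗ[k] U t)

/-- `f` is a morphism of persistence modules (a natural transformation). -/
def IsPersistenceMorphism : Prop :=
  ∀ s t (h : s ≤ t) (x : V s), f t (ρ s t h x) = φ s t h (f s x)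

/-- `Y⁺_{IJ}[f](t) = f(V⁺_{It}) ∩ U⁺_{Jt}`. -/
def Yp (I J : Set ℝ) (t : ℝ) : Submodule k (U t) :=
  (Vp k V ρ I t).map (f t) ⊓ Vp k U φ J t

/-- `Y⁻_{IJ}[f](t) = f(V⁻_{It}) + U⁻_{Jt}`. -/
def Ym (I J : Set ℝ) (t : ℝ) : Submodule k (U t) :=
  (Vm k V ρ I t).map (f t) ⊔ Vm k U φ J t

/-- `X_{IJ}[f](t) = Y⁺_{IJ}[f](t) / (Y⁻_{IJ}[f](t) ∩ Y⁺_{IJ}[f](t))`. -/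
def Xq (I J : Set ℝ) (t : ℝ) : Type :=
  ↥(Yp k V ρ U φ f I J t) ⧸
    Submodule.comap (Yp k V ρ U φ f I J t).subtype (Ym k V ρ U φ f I J t)

instance (I J : Set ℝ) (t : ℝ) : AddCommGroup (Xq k V ρ U φ f I J t) := by
  unfold Xq; infer_instance

instance (I J : Set ℝ) (t : ℝ) : Module k (Xq k V ρ U φ f I J t) := by
  unfold Xq; infer_instance

/-- `upperClosure` of a set of reals: `⟨a, ∞⟩` for `I = ⟨a,b⟩`. -/
def upC (I : Set ℝ) : Set ℝ := {x | ∃ y ∈ I, y ≤ x}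

/-- `lowerClosure` of a set of reals: `⟨-∞, b⟩` for `I = ⟨a,b⟩`. -/
def lowC (I : Set ℝ) : Set ℝ := {x | ∃ y ∈ I, x ≤ y}

end Mor

/-- `I^ε`: the interval `I` with its right endpoint shifted by `+ε`. -/
def shiftSet (I : Set ℝ) (ε : ℝ) : Set ℝ := {x | ∃ y ∈ I, y ≤ x ∧ x ≤ y + ε}

section Shift

variable (V : ℝ → Type) [∀ t, AddCommGroup (V t)] [∀ t, Module k (V t)]
variable (ρ : ∀ s t : ℝ, s ≤ t → (V s →ₗ[k] V t))
variable (ε : ℝ) (hε : 0 < ε)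

/-- The image of the `ε`-transition morphism: `(Im 1_ε^V)(t) = Im ρ_{t,t+ε} ⊆ V_ε(t)`. -/
def oneEpsSub (t : ℝ) : Submodule k (V (t + ε)) :=
  LinearMap.range (ρ t (t + ε) (by linarith))

/-- The structure maps of the persistence module `1_ε(V) = Im 1_ε^V`. -/
def oneEpsρ (hV : IsPersistenceModule k V ρ) (s t : ℝ) (h : s ≤ t) :
    ↥(oneEpsSub k V ρ ε hε s) →ₗ[k] ↥(oneEpsSub k V ρ ε hε t) :=
  (ρ (s + ε) (t + ε) (by linarith)).restrict (by
    rintro x ⟨y, rfl⟩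
    exact ⟨ρ s t h y,
      (hV.2 s t (t + ε) h (by linarith) y).trans
        (hV.2 s (s + ε) (t + ε) (by linarith) (by linarith) y).symm⟩)

variable (U : ℝ → Type) [∀ t, AddCommGroup (U t)] [∀ t, Module k (U t)]
variable (φ : ∀ s t : ℝ, s ≤ t → (U s →ₗ[k] U t))

/-- The morphism `1_ε(f) : Im 1_ε^V → Im 1_ε^U`, the restriction of `f^ε`. -/
def oneEpsf (f : ∀ t, V t →ₗ[k] U t)
    (hf : IsPersistenceMorphism k V ρ U φ f) (t : ℝ) :
    ↥(oneEpsSub k V ρ ε hε t) →ₗ[k] ↥(oneEpsSub k U φ ε hε t) :=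
  (f (t + ε)).restrict (by
    rintro x ⟨y, rfl⟩
    exact ⟨f t y, (hf t (t + ε) (by linarith) y).symm⟩)

end Shift

/-- The left endpoint is unchanged by the shift. -/
theorem not_mem_shiftSet_iff_of_le {I : Set ℝ} (hI : I.OrdConnected) {ε t s : ℝ} (hε : 0 < ε)
    (ht : t ∈ I) (hst : s ≤ t) : s ∉ shiftSet I ε ↔ s ∉ I := by
  refine not_congr ⟨?_, fun hs => ⟨s, hs, le_rfl, by linarith⟩⟩
  rintro ⟨y, hy, hys, -⟩
  exact hI.out hy ht ⟨hys, hst⟩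

/-- The right endpoint is moved by `ε`. -/
theorem add_mem_shiftSet_iff {I : Set ℝ} (hI : I.OrdConnected) {ε t r : ℝ} (hε : 0 < ε)
    (ht : t ∈ I) (htr : t ≤ r) : r + ε ∈ shiftSet I ε ↔ r ∈ I := by
  constructor
  · rintro ⟨y, hy, -, hry⟩
    exact hI.out ht hy ⟨htr, by linarith⟩
  · exact fun hr => ⟨r, hr, by linarith, le_rfl⟩

theorem self_mem_shiftSet {I : Set ℝ} {ε t : ℝ} (hε : 0 < ε) (ht : t ∈ I) :
    t ∈ shiftSet I ε :=
  ⟨t, ht, le_rfl, by linarith⟩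

section OneEps

variable {k}
variable {V : ℝ → Type} [∀ t, AddCommGroup (V t)] [∀ t, Module k (V t)]
variable {ρ : ∀ s t : ℝ, s ≤ t → (V s →ₗ[k] V t)}

theorem IsPersistenceModule.range_mono (hV : IsPersistenceModule k V ρ) {s s' t : ℝ}
    (h : s ≤ s') (h' : s' ≤ t) :
    LinearMap.range (ρ s t (h.trans h')) ≤ LinearMap.range (ρ s' t h') := by
  rintro _ ⟨y, rfl⟩
  exact ⟨ρ s s' h y, hV.2 s s' t h h' y⟩

theorem IsPersistenceModule.ker_mono (hV : IsPersistenceModule k V ρ) {t r r' : ℝ}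
    (h : t ≤ r) (h' : r ≤ r') :
    LinearMap.ker (ρ t r h) ≤ LinearMap.ker (ρ t r' (h.trans h')) := by
  intro x hx
  rw [LinearMap.mem_ker] at hx ⊢
  rw [← hV.2 t r r' h h' x, hx, map_zero]

theorem IsPersistenceModule.mem_KerM_iff (hV : IsPersistenceModule k V ρ) {I : Set ℝ} {t : ℝ}
    (ht : t ∈ I) (x : V t) :
    x ∈ KerM k V ρ I t ↔ ∃ r, ∃ h : t ≤ r, r ∈ I ∧ ρ t r h x = 0 := by
  have : Nonempty {r : ℝ // t ≤ r ∧ r ∈ I} := ⟨⟨t, le_rfl, ht⟩⟩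
  rw [KerM, Submodule.mem_iSup_of_directed]
  · constructor
    · rintro ⟨r, hr⟩
      exact ⟨r.1, r.2.1, r.2.2, hr⟩
    · rintro ⟨r, h, hrI, hr⟩
      exact ⟨⟨r, h, hrI⟩, hr⟩
  · intro r r'
    rcases le_total r.1 r'.1 with h | h
    · exact ⟨r', hV.ker_mono r.2.1 h, le_rfl⟩
    · exact ⟨r, le_rfl, hV.ker_mono r'.2.1 h⟩

variable {ε : ℝ} {hε : 0 < ε}

theorem oneEpsρ_apply_coe (hV : IsPersistenceModule k V ρ) {s t : ℝ} (h : s ≤ t)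
    (x : oneEpsSub k V ρ ε hε s) :
    (oneEpsρ k V ρ ε hε hV s t h x : V (t + ε)) = ρ (s + ε) (t + ε) (by linarith) x :=
  rfl

theorem isPersistenceModule_oneEps (hV : IsPersistenceModule k V ρ) :
    IsPersistenceModule k (fun r => ↥(oneEpsSub k V ρ ε hε r)) (oneEpsρ k V ρ ε hε hV) :=
  ⟨fun _ _ => Subtype.ext (hV.1 _ _), fun _ _ _ _ _ _ => Subtype.ext (hV.2 _ _ _ _ _ _)⟩

theorem map_range_oneEpsρ (hV : IsPersistenceModule k V ρ) {s t : ℝ} (h : s ≤ t) :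
    (LinearMap.range (oneEpsρ k V ρ ε hε hV s t h)).map (oneEpsSub k V ρ ε hε t).subtype =
      LinearMap.range (ρ s (t + ε) (by linarith)) := by
  apply le_antisymm
  · rintro _ ⟨_, ⟨⟨_, z, rfl⟩, rfl⟩, rfl⟩
    exact ⟨z, (hV.2 s (s + ε) (t + ε) (by linarith) (by linarith) z).symm⟩
  · rintro _ ⟨z, rfl⟩
    exact ⟨_, ⟨⟨ρ s (s + ε) (by linarith) z, z, rfl⟩, rfl⟩,
      hV.2 s (s + ε) (t + ε) (by linarith) (by linarith) z⟩

variable {I : Set ℝ} {t : ℝ}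

theorem map_ImP_oneEps (hV : IsPersistenceModule k V ρ) (ht : t ∈ I) :
    (ImP k _ (oneEpsρ k V ρ ε hε hV) I t).map (oneEpsSub k V ρ ε hε t).subtype =
      ImP k V ρ (shiftSet I ε) (t + ε) := by
  have : Nonempty {s : ℝ // s ≤ t ∧ s ∈ I} := ⟨⟨t, le_rfl, ht⟩⟩
  rw [ImP, ImP, Submodule.map_iInf _ (Submodule.injective_subtype _)]
  simp only [map_range_oneEpsρ]
  apply le_antisymm
  · refine le_iInf fun s => ?_
    obtain ⟨s, hs, y, hy, hys, -⟩ := s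
    have hm : min y t ∈ I := by
      rcases min_choice y t with h | h <;> rw [h] <;> assumption
    exact (iInf_le _ (⟨min y t, min_le_right _ _, hm⟩ : {s : ℝ // s ≤ t ∧ s ∈ I})).trans
      (hV.range_mono ((min_le_left _ _).trans hys) hs)
  · refine le_iInf fun s => ?_
    exact iInf_le _ (⟨s.1, by linarith [s.2.1], self_mem_shiftSet hε s.2.2⟩ :
      {s : ℝ // s ≤ t + ε ∧ s ∈ shiftSet I ε})

theorem map_ImM_oneEps (hV : IsPersistenceModule k V ρ) (hI : I.OrdConnected) (ht : t ∈ I) :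
    (ImM k _ (oneEpsρ k V ρ ε hε hV) I t).map (oneEpsSub k V ρ ε hε t).subtype =
      ImM k V ρ (shiftSet I ε) (t + ε) := by
  rw [ImM, ImM, Submodule.map_iSup]
  simp only [map_range_oneEpsρ]
  apply le_antisymm
  · refine iSup_le fun s => ?_
    exact le_iSup_of_le (⟨s.1, by linarith [s.2.1],
      (not_mem_shiftSet_iff_of_le hI hε ht s.2.1).2 s.2.2⟩ :
        {s : ℝ // s ≤ t + ε ∧ s ∉ shiftSet I ε}) le_rfl
  · refine iSup_le fun s => ?_
    have hst : s.1 ≤ t := by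
      by_contra! h
      exact s.2.2 ⟨t, ht, h.le, s.2.1⟩
    exact le_iSup_of_le (⟨s.1, hst, (not_mem_shiftSet_iff_of_le hI hε ht hst).1 s.2.2⟩ :
      {s : ℝ // s ≤ t ∧ s ∉ I}) le_rfl

theorem KerP_oneEps (hV : IsPersistenceModule k V ρ) (hI : I.OrdConnected) (ht : t ∈ I) :
    KerP k _ (oneEpsρ k V ρ ε hε hV) I t =
      (KerP k V ρ (shiftSet I ε) (t + ε)).comap (oneEpsSub k V ρ ε hε t).subtype := by
  ext x
  simp only [KerP, Submodule.mem_comap, Submodule.mem_iInf, LinearMap.mem_ker]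
  constructor
  · rintro h ⟨r, hr, hrI⟩
    obtain ⟨r, rfl⟩ : ∃ r', r = r' + ε := ⟨r - ε, by ring⟩
    have htr : t ≤ r := by linarith
    exact congrArg Subtype.val (h ⟨r, htr,
      fun hr' => hrI ((add_mem_shiftSet_iff hI hε ht htr).2 hr')⟩)
  · rintro h ⟨r, hr, hrI⟩
    exact Subtype.ext (h ⟨r + ε, by linarith,
      fun hr' => hrI ((add_mem_shiftSet_iff hI hε ht hr).1 hr')⟩)

theorem KerM_oneEps (hV : IsPersistenceModule k V ρ) (hI : I.OrdConnected) (ht : t ∈ I) :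
    KerM k _ (oneEpsρ k V ρ ε hε hV) I t =
      (KerM k V ρ (shiftSet I ε) (t + ε)).comap (oneEpsSub k V ρ ε hε t).subtype := by
  ext x
  rw [(isPersistenceModule_oneEps hV).mem_KerM_iff ht, Submodule.mem_comap,
    hV.mem_KerM_iff ((add_mem_shiftSet_iff hI hε ht le_rfl).2 ht)]
  constructor
  · rintro ⟨r, hr, hrI, h⟩
    exact ⟨r + ε, by linarith, (add_mem_shiftSet_iff hI hε ht hr).2 hrI, congrArg Subtype.val h⟩
  · rintro ⟨r, hr, hrI, h⟩
    obtain ⟨r, rfl⟩ : ∃ r', r = r' + ε := ⟨r - ε, by ring⟩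
    have htr : t ≤ r := by linarith
    exact ⟨r, htr, (add_mem_shiftSet_iff hI hε ht htr).1 hrI, Subtype.ext h⟩

theorem map_Vp_oneEps (hV : IsPersistenceModule k V ρ) (hI : I.OrdConnected) (ht : t ∈ I) :
    (Vp k _ (oneEpsρ k V ρ ε hε hV) I t).map (oneEpsSub k V ρ ε hε t).subtype =
      Vp k V ρ (shiftSet I ε) (t + ε) := by
  rw [Vp, Vp, if_pos ht, if_pos ((add_mem_shiftSet_iff hI hε ht le_rfl).2 ht),
    KerP_oneEps hV hI ht, ← Submodule.map_inf_eq_map_inf_comap, map_ImP_oneEps hV ht]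

theorem map_Vm_oneEps (hV : IsPersistenceModule k V ρ) (hI : I.OrdConnected) (ht : t ∈ I) :
    (Vm k _ (oneEpsρ k V ρ ε hε hV) I t).map (oneEpsSub k V ρ ε hε t).subtype =
      Vm k V ρ (shiftSet I ε) (t + ε) := by
  rw [Vm, Vm, if_pos ht, if_pos ((add_mem_shiftSet_iff hI hε ht le_rfl).2 ht),
    KerP_oneEps hV hI ht, KerM_oneEps hV hI ht, Submodule.map_sup, ← Submodule.map_inf_eq_map_inf_comap,
    ← Submodule.map_inf_eq_map_inf_comap, map_ImP_oneEps hV ht, map_ImM_oneEps hV hI ht]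

variable {U : ℝ → Type} [∀ t, AddCommGroup (U t)] [∀ t, Module k (U t)]
variable {φ : ∀ s t : ℝ, s ≤ t → (U s →ₗ[k] U t)} {f : ∀ t, V t →ₗ[k] U t}

theorem map_map_oneEpsf (hf : IsPersistenceMorphism k V ρ U φ f)
    (p : Submodule k (oneEpsSub k V ρ ε hε t)) :
    (p.map (oneEpsf k V ρ ε hε U φ f hf t)).map (oneEpsSub k U φ ε hε t).subtype =
      (p.map (oneEpsSub k V ρ ε hε t).subtype).map (f (t + ε)) := by
  rw [← Submodule.map_comp, ← Submodule.map_comp]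
  rfl

variable {J : Set ℝ}

theorem map_Yp_oneEps (hV : IsPersistenceModule k V ρ) (hU : IsPersistenceModule k U φ)
    (hf : IsPersistenceMorphism k V ρ U φ f) (hI : I.OrdConnected) (hJ : J.OrdConnected)
    (htI : t ∈ I) (htJ : t ∈ J) :
    (Yp k _ (oneEpsρ k V ρ ε hε hV) _ (oneEpsρ k U φ ε hε hU)
        (oneEpsf k V ρ ε hε U φ f hf) I J t).map (oneEpsSub k U φ ε hε t).subtype =
      Yp k V ρ U φ f (shiftSet I ε) (shiftSet J ε) (t + ε) := by
  rw [Yp, Yp, Submodule.map_inf _ (Submodule.injective_subtype _), map_map_oneEpsf,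
    map_Vp_oneEps hV hI htI, map_Vp_oneEps hU hJ htJ]

theorem map_Ym_oneEps (hV : IsPersistenceModule k V ρ) (hU : IsPersistenceModule k U φ)
    (hf : IsPersistenceMorphism k V ρ U φ f) (hI : I.OrdConnected) (hJ : J.OrdConnected)
    (htI : t ∈ I) (htJ : t ∈ J) :
    (Ym k _ (oneEpsρ k V ρ ε hε hV) _ (oneEpsρ k U φ ε hε hU)
        (oneEpsf k V ρ ε hε U φ f hf) I J t).map (oneEpsSub k U φ ε hε t).subtype =
      Ym k V ρ U φ f (shiftSet I ε) (shiftSet J ε) (t + ε) := by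
  rw [Ym, Ym, Submodule.map_sup, map_map_oneEpsf,
    map_Vm_oneEps hV hI htI, map_Vm_oneEps hU hJ htJ]

end OneEps

/-- An injective linear map identifies the subquotient `p / (q ∩ p)` with its image. -/
theorem nonempty_subquotient_equiv_map {R M N : Type*} [Ring R] [AddCommGroup M] [Module R M]
    [AddCommGroup N] [Module R N] (g : M →ₗ[R] N) (hg : Function.Injective g)
    {p q : Submodule R M} {p' q' : Submodule R N} (hp : p.map g = p') (hq : q.map g = q') :
    Nonempty ((p ⧸ q.comap p.subtype) ≃ₗ[R] (p' ⧸ q'.comap p'.subtype)) := by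
  subst hp hq
  refine ⟨Submodule.Quotient.equiv _ _ (Submodule.equivMapOfInjective g hg p) ?_⟩
  ext ⟨_, x, hx, rfl⟩
  constructor
  · rintro ⟨y, hy, hyx⟩
    exact ⟨y, hy, congrArg Subtype.val hyx⟩
  · rintro ⟨y, hy, hyx⟩
    obtain rfl := hg hyx
    exact ⟨⟨y, hx⟩, hy, rfl⟩

/-- for every `t ∈ I ∩ J`,
`X_{IJ}[1_ε(f)](t) ≅ X_{I^ε J^ε}[f](t + ε)`. -/
theorem stmt_16
    (V : ℝ → Type) [∀ t, AddCommGroup (V t)] [∀ t, Module k (V t)]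
    (ρ : ∀ s t : ℝ, s ≤ t → (V s →ₗ[k] V t))
    (U : ℝ → Type) [∀ t, AddCommGroup (U t)] [∀ t, Module k (U t)]
    (φ : ∀ s t : ℝ, s ≤ t → (U s →ₗ[k] U t))
    (hV : IsPersistenceModule k V ρ) (hU : IsPersistenceModule k U φ)
    (hVi : DCCImages k V ρ) (hVk : DCCKernels k V ρ)
    (hUi : DCCImages k U φ) (hUk : DCCKernels k U φ)
    (f : ∀ t, V t →ₗ[k] U t) (hf : IsPersistenceMorphism k V ρ U φ f)
    (ε : ℝ) (hε : 0 < ε)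
    (I J : Set ℝ) (hI : I.OrdConnected) (hJ : J.OrdConnected) :
    ∀ t ∈ I ∩ J,
      Nonempty
        (Xq k (fun r => ↥(oneEpsSub k V ρ ε hε r)) (oneEpsρ k V ρ ε hε hV)
            (fun r => ↥(oneEpsSub k U φ ε hε r)) (oneEpsρ k U φ ε hε hU)
            (oneEpsf k V ρ ε hε U φ f hf) I J t ≃ₗ[k]
          Xq k V ρ U φ f (shiftSet I ε) (shiftSet J ε) (t + ε)) := by
  rintro t ⟨htI, htJ⟩
  exact nonempty_subquotient_equiv_map _ (Submodule.injective_subtype _)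
    (map_Yp_oneEps hV hU hf hI hJ htI htJ) (map_Ym_oneEps hV hU hf hI hJ htI htJ)
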